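/- In the broadcasting model on the rooted tree in which every vertex has exactly c children and each edge flips the transmitted bit independently with probability ε ∈ [0,1]: if c(1−2ε)² > 1, then reconstruction is solvable, i.e., lim_{t→∞} E| P(X^(0) = 1 | X^(t)) − 1/2 | > 0, where X^(0) is the uniform root bit and X^(t) is the vector of bits at depth t. -/

import Mathlib

open Filter

/-- `leafProb c ε t b y` is the probability that, in the broadcasting model on the
`c`-ary tree with flip probability `ε` and root bit `b`, the bits at depth `t`
(indexed by addresses `Fin t → Fin c`) equal `y`. -/
noncomputable def leafProb (c : ℕ) (ε : ℝ) : (t : ℕ) → Bool → ((Fin t → Fin c) → Bool) → ℝ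
  | 0, b, y => if y (fun i => i.elim0) = b then 1 else 0
  | t + 1, b, y =>
      ∏ j : Fin c, ∑ b' : Bool,
        (if b' = b then 1 - ε else ε) * leafProb c ε t b' (fun f => y (Fin.cons j f))

/-- `E |P(X⁽⁰⁾ = 1 | X⁽ᵗ⁾) − 1/2|` for the broadcasting model on the `c`-ary tree,
the root bit being uniform. -/
noncomputable def reconQuantity (c : ℕ) (ε : ℝ) (t : ℕ) : ℝ :=
  ∑ y : (Fin t → Fin c) → Bool,
    (leafProb c ε t true y + leafProb c ε t false y) / 2 *
      |leafProb c ε t true y / (leafProb c ε t true y + leafProb c ε t false y) - 1 / 2|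

/-- A labelling of depth `t + 1` is the same as a family of labellings of depth `t`, one for each
child of the root. -/
def subtreeEquiv (c t : ℕ) :
    ((Fin (t + 1) → Fin c) → Bool) ≃ (Fin c → ((Fin t → Fin c) → Bool)) where
  toFun y j f := y (Fin.cons j f)
  invFun Y f := Y (f 0) (Fin.tail f)
  left_inv y := by ext f; simp
  right_inv Y := by ext j f; simp

/-- The law of the labelling of depth `t` below one child of a root with bit `b`. -/
noncomputable def childProb (c : ℕ) (ε : ℝ) (t : ℕ) (b : Bool) (y : (Fin t → Fin c) → Bool) : ℝ :=
  ∑ b' : Bool, (if b' = b then 1 - ε else ε) * leafProb c ε t b' y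

lemma leafProb_succ (c : ℕ) (ε : ℝ) (t : ℕ) (b : Bool) (y : (Fin (t + 1) → Fin c) → Bool) :
    leafProb c ε (t + 1) b y = ∏ j, childProb c ε t b (subtreeEquiv c t y j) := rfl

lemma leafProb_nonneg {c : ℕ} {ε : ℝ} (hε : ε ∈ Set.Icc (0 : ℝ) 1) (t : ℕ) (b : Bool)
    (y : (Fin t → Fin c) → Bool) : 0 ≤ leafProb c ε t b y := by
  induction t generalizing b with
  | zero => simp only [leafProb]; split_ifs <;> norm_num
  | succ t ih =>
    refine Finset.prod_nonneg fun j _ => Finset.sum_nonneg fun b' _ => mul_nonneg ?_ (ih _ _)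
    split_ifs <;> linarith [hε.1, hε.2]

lemma sum_childProb_mul (c : ℕ) (ε : ℝ) (t : ℕ) (b : Bool) (g : ((Fin t → Fin c) → Bool) → ℝ) :
    ∑ y, childProb c ε t b y * g y =
      (1 - ε) * ∑ y, leafProb c ε t b y * g y + ε * ∑ y, leafProb c ε t (!b) y * g y := by
  rw [Finset.mul_sum, Finset.mul_sum, ← Finset.sum_add_distrib]
  refine Finset.sum_congr rfl fun y _ => ?_
  cases b <;> simp [childProb] <;> ring

lemma sum_fin_succ_pi {α : Type*} [Fintype α] (n : ℕ) (F : (Fin (n + 1) → α) → ℝ) :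
    ∑ Y, F Y = ∑ a, ∑ Y : Fin n → α, F (Fin.cons a Y) := by
  rw [← Fintype.sum_prod_type']
  exact (Fintype.sum_equiv (Fin.consEquiv fun _ => α) _ _ fun _ => rfl).symm

/-- Total mass and the first two moments of a sum of independent copies. -/
lemma iid_sum_moments {α : Type*} [Fintype α] (Q f : α → ℝ) (hQ : ∑ a, Q a = 1) (n : ℕ) :
    (∑ Y : Fin n → α, ∏ j, Q (Y j) = 1) ∧
    (∑ Y : Fin n → α, (∏ j, Q (Y j)) * ∑ j, f (Y j) = n * ∑ a, Q a * f a) ∧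
    (∑ Y : Fin n → α, (∏ j, Q (Y j)) * (∑ j, f (Y j)) ^ 2 =
      n * ∑ a, Q a * f a ^ 2 + n * (n - 1) * (∑ a, Q a * f a) ^ 2) := by
  induction n with
  | zero => simp
  | succ n ih =>
    obtain ⟨h0, h1, h2⟩ := ih
    simp only [sum_fin_succ_pi, Fin.prod_univ_succ, Fin.sum_univ_succ, Fin.cons_zero, Fin.cons_succ]
    refine ⟨by simp only [← Finset.mul_sum, h0, mul_one, hQ], ?_, ?_⟩
    · have key (a : α) : ∑ Y : Fin n → α, Q a * (∏ j, Q (Y j)) * (f a + ∑ j, f (Y j)) =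
          Q a * f a + Q a * (n * ∑ a, Q a * f a) := by
        rw [← h1, ← mul_one (Q a * f a), ← h0, Finset.mul_sum, Finset.mul_sum,
          ← Finset.sum_add_distrib]
        exact Finset.sum_congr rfl fun Y _ => by ring
      simp only [key, Finset.sum_add_distrib, ← Finset.sum_mul, hQ]
      push_cast
      ring
    · have key (a : α) : ∑ Y : Fin n → α, Q a * (∏ j, Q (Y j)) * (f a + ∑ j, f (Y j)) ^ 2 =
          Q a * f a ^ 2 + Q a * f a * (2 * (n * ∑ a, Q a * f a)) +
          Q a * (n * ∑ a, Q a * f a ^ 2 + n * (n - 1) * (∑ a, Q a * f a) ^ 2) := by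
        rw [← h1, ← h2, ← mul_one (Q a * f a ^ 2), ← h0, Finset.mul_sum, Finset.mul_sum,
          Finset.mul_sum, Finset.mul_sum, ← Finset.sum_add_distrib, ← Finset.sum_add_distrib]
        exact Finset.sum_congr rfl fun Y _ => by ring
      simp only [key, Finset.sum_add_distrib, ← Finset.sum_mul, hQ]
      push_cast
      ring

/-- The spin `±1` of a bit. -/
def spin (b : Bool) : ℝ := if b then 1 else -1

/-- The sum of the spins at depth `t`, divided by `(c (1 - 2 ε)) ^ t`. -/
noncomputable def magnetization (c : ℕ) (ε : ℝ) : (t : ℕ) → ((Fin t → Fin c) → Bool) → ℝ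
  | 0, y => spin (y fun i => i.elim0)
  | t + 1, y =>
      (c * (1 - 2 * ε))⁻¹ * ∑ j, magnetization c ε t (subtreeEquiv c t y j)

lemma sum_leafProb_zero_mul (c : ℕ) (ε : ℝ) (b : Bool) (g : Bool → ℝ) :
    ∑ y, leafProb c ε 0 b y * g (y fun i => i.elim0) = g b := by
  rw [Fintype.sum_eq_single (fun _ => b)]
  · simp [leafProb]
  · intro y hy
    have : y (fun i => i.elim0) ≠ b := fun h => hy (funext fun f => by
      rw [← h]; exact congrArg y (Subsingleton.elim _ _))
    simp [leafProb, this]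

lemma sum_leafProb (c : ℕ) (ε : ℝ) (t : ℕ) (b : Bool) : ∑ y, leafProb c ε t b y = 1 := by
  induction t generalizing b with
  | zero => simpa using sum_leafProb_zero_mul c ε b fun _ => 1
  | succ t ih =>
    have hQ : ∑ y, childProb c ε t b y = 1 := by
      have := sum_childProb_mul c ε t b fun _ => 1
      simp only [mul_one, ih] at this
      rw [this]; ring
    rw [← (iid_sum_moments _ 0 hQ c).1]
    exact Fintype.sum_equiv (subtreeEquiv c t) _ _ fun y => leafProb_succ c ε t b y

lemma sum_childProb (c : ℕ) (ε : ℝ) (t : ℕ) (b : Bool) : ∑ y, childProb c ε t b y = 1 := by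
  have := sum_childProb_mul c ε t b fun _ => 1
  simp only [mul_one, sum_leafProb] at this
  rw [this]; ring

lemma sum_leafProb_mul_magnetization {c : ℕ} {ε : ℝ} (hc : (c : ℝ) * (1 - 2 * ε) ≠ 0) (t : ℕ)
    (b : Bool) : ∑ y, leafProb c ε t b y * magnetization c ε t y = spin b := by
  induction t generalizing b with
  | zero => exact sum_leafProb_zero_mul c ε b spin
  | succ t ih =>
    have h1 := (iid_sum_moments _ (magnetization c ε t) (sum_childProb c ε t b) c).2.1
    rw [sum_childProb_mul, ih, ih] at h1
    have hs : (c : ℝ) * ((1 - ε) * spin b + ε * spin (!b)) = c * (1 - 2 * ε) * spin b := by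
      rw [mul_assoc]
      congr 1
      cases b <;> simp [spin] <;> ring
    rw [hs] at h1
    rw [← inv_mul_cancel_left₀ hc (spin b), ← h1, Finset.mul_sum]
    refine Fintype.sum_equiv (subtreeEquiv c t) _ _ fun y => ?_
    rw [leafProb_succ, magnetization]
    ring

lemma sum_leafProb_mul_magnetization_sq_le {c : ℕ} {ε : ℝ} (hε : ε ∈ Set.Icc (0 : ℝ) 1)
    (h : 1 < (c : ℝ) * (1 - 2 * ε) ^ 2) (t : ℕ) (b : Bool) :
    ∑ y, leafProb c ε t b y * magnetization c ε t y ^ 2 ≤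
      (1 - ((c : ℝ) * (1 - 2 * ε) ^ 2)⁻¹)⁻¹ := by
  set r := ((c : ℝ) * (1 - 2 * ε) ^ 2)⁻¹ with hr
  have hθ : 1 - 2 * ε ≠ 0 := by rintro h0; norm_num [h0] at h
  have hc : (c : ℝ) ≠ 0 := by rintro h0; norm_num [h0] at h
  have hr0 : 0 < r := by positivity
  have hr1 : r < 1 := inv_lt_one_of_one_lt₀ h
  have hA : r * (1 - r)⁻¹ + 1 = (1 - r)⁻¹ := by
    have : 1 - r ≠ 0 := by linarith
    field_simp; ring
  induction t generalizing b with
  | zero =>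
    have := sum_leafProb_zero_mul c ε b fun b => spin b ^ 2
    simp only [magnetization]
    rw [this]
    have hs : spin b ^ 2 = 1 := by cases b <;> simp [spin]
    rw [hs]
    exact (one_le_inv₀ (by linarith)).2 (by linarith)
  | succ t ih =>
    have h2 := (iid_sum_moments _ (magnetization c ε t) (sum_childProb c ε t b) c).2.2
    have hm : (∑ y, childProb c ε t b y * magnetization c ε t y) ^ 2 = (1 - 2 * ε) ^ 2 := by
      rw [sum_childProb_mul, sum_leafProb_mul_magnetization (mul_ne_zero hc hθ),
        sum_leafProb_mul_magnetization (mul_ne_zero hc hθ)]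
      cases b <;> simp [spin] <;> ring
    have hv : ∑ y, childProb c ε t b y * magnetization c ε t y ^ 2 ≤ (1 - r)⁻¹ := by
      rw [sum_childProb_mul]
      nlinarith [mul_le_mul_of_nonneg_left (ih b) (sub_nonneg.2 hε.2),
        mul_le_mul_of_nonneg_left (ih (!b)) hε.1]
    have e : ∑ y, leafProb c ε (t + 1) b y * magnetization c ε (t + 1) y ^ 2 =
        ((c * (1 - 2 * ε))⁻¹) ^ 2 * (c * ∑ y, childProb c ε t b y * magnetization c ε t y ^ 2 +
          c * (c - 1) * (1 - 2 * ε) ^ 2) := by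
      rw [← hm, ← h2, Finset.mul_sum]
      refine Fintype.sum_equiv (subtreeEquiv c t) _ _ fun y => ?_
      rw [leafProb_succ, magnetization]
      ring
    have e' : ∑ y, leafProb c ε (t + 1) b y * magnetization c ε (t + 1) y ^ 2 =
        r * ∑ y, childProb c ε t b y * magnetization c ε t y ^ 2 + (1 - (c : ℝ)⁻¹) := by
      rw [e, hr]
      field_simp
    rw [e', ← hA]
    have : 0 ≤ (c : ℝ)⁻¹ := by positivity
    nlinarith [mul_le_mul_of_nonneg_left hv hr0.le]

lemma reconQuantity_eq {c : ℕ} {ε : ℝ} (hε : ε ∈ Set.Icc (0 : ℝ) 1) (t : ℕ) :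
    reconQuantity c ε t = (∑ y, |leafProb c ε t true y - leafProb c ε t false y|) / 4 := by
  rw [reconQuantity, Finset.sum_div]
  refine Finset.sum_congr rfl fun y _ => ?_
  have h1 := leafProb_nonneg hε t true y
  have h0 := leafProb_nonneg hε t false y
  generalize leafProb c ε t true y = p at *
  generalize leafProb c ε t false y = q at *
  rcases (add_nonneg h1 h0).eq_or_lt with hs | hs
  · have hp : p = 0 := by linarith
    have hq : q = 0 := by linarith
    simp [hp, hq]
  · have : p / (p + q) - 1 / 2 = (p - q) / (2 * (p + q)) := by field_simp; ring
    rw [this, abs_div, abs_of_pos (by positivity : 0 < 2 * (p + q))]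
    field_simp
    ring

/-- The labelling of depth `t + 1` is obtained from that of depth `t` by a stochastic kernel that
does not depend on the root bit. -/
lemma exists_leaf_kernel {c : ℕ} {ε : ℝ} (hε : ε ∈ Set.Icc (0 : ℝ) 1) (t : ℕ) :
    ∃ K : ((Fin t → Fin c) → Bool) → ((Fin (t + 1) → Fin c) → Bool) → ℝ,
      (∀ x y, 0 ≤ K x y) ∧ (∀ x, ∑ y, K x y = 1) ∧
      ∀ b y, leafProb c ε (t + 1) b y = ∑ x, leafProb c ε t b x * K x y := by
  induction t with
  | zero =>
    exact ⟨fun x y => leafProb c ε 1 (x fun i => i.elim0) y, fun x y => leafProb_nonneg hε _ _ _,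
      fun x => sum_leafProb _ _ _ _,
      fun b y => (sum_leafProb_zero_mul c ε b fun b => leafProb c ε 1 b y).symm⟩
  | succ t ih =>
    obtain ⟨K, hK0, hK1, hK⟩ := ih
    refine ⟨fun x y => ∏ j, K (subtreeEquiv c t x j) (subtreeEquiv c (t + 1) y j),
      fun x y => Finset.prod_nonneg fun j _ => hK0 _ _, fun x => ?_, fun b y => ?_⟩
    · rw [Fintype.sum_equiv (subtreeEquiv c (t + 1)) _
        (fun Y => ∏ j, K (subtreeEquiv c t x j) (Y j)) fun y => rfl]
      rw [← Fintype.prod_sum]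
      simp [hK1]
    · have hchild (z) : childProb c ε (t + 1) b z = ∑ x, childProb c ε t b x * K x z := by
        rw [sum_childProb_mul, ← hK, ← hK]
        cases b <;> simp [childProb, add_comm]
      rw [leafProb_succ]
      simp only [hchild]
      rw [Fintype.prod_sum]
      refine (Fintype.sum_equiv (subtreeEquiv c t) _ _ fun x => ?_).symm
      rw [leafProb_succ, Finset.prod_mul_distrib]

lemma sum_abs_sum_mul_le {α β : Type*} [Fintype α] [Fintype β] (d : α → ℝ) (K : α → β → ℝ)
    (hK0 : ∀ x y, 0 ≤ K x y) (hK1 : ∀ x, ∑ y, K x y = 1) :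
    ∑ y, |∑ x, d x * K x y| ≤ ∑ x, |d x| := by
  calc ∑ y, |∑ x, d x * K x y| ≤ ∑ y, ∑ x, |d x| * K x y := by
        refine Finset.sum_le_sum fun y _ => (Finset.abs_sum_le_sum_abs _ _).trans_eq ?_
        exact Finset.sum_congr rfl fun x _ => by rw [abs_mul, abs_of_nonneg (hK0 x y)]
    _ = ∑ x, |d x| := by
        rw [Finset.sum_comm]
        exact Finset.sum_congr rfl fun x _ => by rw [← Finset.mul_sum, hK1, mul_one]

lemma reconQuantity_antitone {c : ℕ} {ε : ℝ} (hε : ε ∈ Set.Icc (0 : ℝ) 1) :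
    Antitone fun t => reconQuantity c ε t := by
  refine antitone_nat_of_succ_le fun t => ?_
  obtain ⟨K, hK0, hK1, hK⟩ := exists_leaf_kernel (c := c) hε t
  rw [reconQuantity_eq hε, reconQuantity_eq hε]
  gcongr ?_ / 4
  simp only [hK, ← Finset.sum_sub_distrib, ← sub_mul]
  exact sum_abs_sum_mul_le _ K hK0 hK1

/-- A statistic `f` with means differing by `m` and second moments at most `A` under two finite
measures `p` and `q` forces their `ℓ¹` distance to be bounded below. -/
lemma le_sum_abs_sub_of_second_moment {α : Type*} [Fintype α] (p q f : α → ℝ) {A m : ℝ}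
    (hA : 0 < A) (hp : ∀ x, 0 ≤ p x) (hq : ∀ x, 0 ≤ q x)
    (hm : ∑ x, p x * f x - ∑ x, q x * f x = m)
    (hp2 : ∑ x, p x * f x ^ 2 ≤ A) (hq2 : ∑ x, q x * f x ^ 2 ≤ A) :
    2 * (m - 1) / A ≤ ∑ x, |p x - q x| := by
  have hpt (x : α) : p x * f x - q x * f x ≤
      (p x * f x ^ 2 + q x * f x ^ 2) / (2 * A) + A / 2 * |p x - q x| := by
    have hd : |p x - q x| ≤ p x + q x :=
      abs_sub_le_iff.2 ⟨by linarith [hq x], by linarith [hp x]⟩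
    have h1 : |f x| ≤ f x ^ 2 / (2 * A) + A / 2 := by
      rw [← sq_abs, div_add_div _ _ (by positivity) two_ne_zero, le_div_iff₀ (by positivity)]
      nlinarith [sq_nonneg (|f x| - A)]
    calc p x * f x - q x * f x = (p x - q x) * f x := by ring
      _ ≤ |p x - q x| * |f x| := by rw [← abs_mul]; exact le_abs_self _
      _ ≤ |p x - q x| * (f x ^ 2 / (2 * A) + A / 2) := by gcongr
      _ = |p x - q x| * (f x ^ 2 / (2 * A)) + A / 2 * |p x - q x| := by ring
      _ ≤ (p x + q x) * (f x ^ 2 / (2 * A)) + A / 2 * |p x - q x| := by gcongr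
      _ = _ := by ring
  have hsum := Finset.sum_le_sum fun x (_ : x ∈ Finset.univ) => hpt x
  rw [Finset.sum_sub_distrib, hm, Finset.sum_add_distrib, ← Finset.sum_div,
    Finset.sum_add_distrib, ← Finset.mul_sum] at hsum
  have h1 : (∑ x, p x * f x ^ 2 + ∑ x, q x * f x ^ 2) / (2 * A) ≤ 1 := by
    rw [div_le_one (by positivity)]; linarith
  rw [div_le_iff₀ hA]
  linarith

/-- Kesten–Stigum: if `c(1−2ε)² > 1`, reconstruction on the `c`-ary tree is solvable:
`lim_{t→∞} E|P(X⁽⁰⁾=1|X⁽ᵗ⁾) − 1/2| > 0`. -/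
theorem tree_reconstruction_above_KS (c : ℕ) (ε : ℝ) (hε : ε ∈ Set.Icc (0 : ℝ) 1)
    (h : 1 < (c : ℝ) * (1 - 2 * ε) ^ 2) :
    ∃ L > (0 : ℝ), Tendsto (fun t => reconQuantity c ε t) atTop (nhds L) := by
  have hc : (c : ℝ) * (1 - 2 * ε) ≠ 0 := by
    intro h0
    rw [sq, ← mul_assoc, h0] at h
    norm_num at h
  set A := (1 - ((c : ℝ) * (1 - 2 * ε) ^ 2)⁻¹)⁻¹
  have hA : 0 < A := inv_pos.2 (sub_pos.2 (inv_lt_one_of_one_lt₀ h))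
  have hlb (t : ℕ) : 1 / (2 * A) ≤ reconQuantity c ε t := by
    have := le_sum_abs_sub_of_second_moment (leafProb c ε t true) (leafProb c ε t false)
      (magnetization c ε t) (m := 2) hA (leafProb_nonneg hε t true) (leafProb_nonneg hε t false)
      (by
        rw [sum_leafProb_mul_magnetization hc, sum_leafProb_mul_magnetization hc]
        norm_num [spin])
      (sum_leafProb_mul_magnetization_sq_le hε h t true)
      (sum_leafProb_mul_magnetization_sq_le hε h t false)
    rw [reconQuantity_eq hε]
    calc 1 / (2 * A) = 2 * (2 - 1) / A / 4 := by ring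
      _ ≤ _ := by gcongr
  have hlim := tendsto_atTop_ciInf (reconQuantity_antitone (c := c) hε)
    ⟨1 / (2 * A), by rintro _ ⟨t, rfl⟩; exact hlb t⟩
  exact ⟨_, (by positivity : 0 < 1 / (2 * A)).trans_le (le_ciInf hlb), hlim⟩
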